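/- The two stone boundary words in the letters X, Y, Z evaluate to minus the identity matrix: S₁ = Z·Z·Y·Y·X·X = −I and S₂ = y·Z·x·Y·z·X = −I. -/

import Mathlib

open Matrix

/-- `ω = exp(2πi/12)`, a primitive 12th root of unity. -/
noncomputable def ω : ℂ := Complex.exp (2 * Real.pi * Complex.I / 12)

/-- The SL₂(ℂ) connection matrix on northeast edges. -/
noncomputable def α : Matrix (Fin 2) (Fin 2) ℂ := !![ω^7, 0; 0, ω^5]

/-- The SL₂(ℂ) connection matrix on northwest edges. -/
noncomputable def β : Matrix (Fin 2) (Fin 2) ℂ := !![ω^7, ω^3; 0, ω^5]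

/-- The SL₂(ℂ) connection matrix on horizontal edges. -/
noncomputable def γ : Matrix (Fin 2) (Fin 2) ℂ := !![ω^5, 0; ω^3, ω^7]

/-- The length-two move `X = β·α`. -/
noncomputable def X : Matrix (Fin 2) (Fin 2) ℂ := β * α

/-- The length-two move `Y = α⁻¹·γ`. -/
noncomputable def Y : Matrix (Fin 2) (Fin 2) ℂ := α⁻¹ * γ

/-- The length-two move `Z = γ⁻¹·β⁻¹`. -/
noncomputable def Z : Matrix (Fin 2) (Fin 2) ℂ := γ⁻¹ * β⁻¹

/-- `x = X⁻¹`. -/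
noncomputable def x : Matrix (Fin 2) (Fin 2) ℂ := X⁻¹

/-- `y = Y⁻¹`. -/
noncomputable def y : Matrix (Fin 2) (Fin 2) ℂ := Y⁻¹

/-- `z = Z⁻¹`. -/
noncomputable def z : Matrix (Fin 2) (Fin 2) ℂ := Z⁻¹

/-- The twelfth cyclotomic relation for `ω`. -/
lemma ω_cyclotomic : ω ^ 4 = ω ^ 2 - 1 := by
  have h3 : ω ^ 3 = Complex.I := by
    rw [ω, ← Complex.exp_nat_mul]
    refine Eq.trans ?_ Complex.exp_pi_div_two_mul_I
    congr 1
    push_cast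
    ring
  have hprim : IsPrimitiveRoot ω 12 := by
    have h := Complex.isPrimitiveRoot_exp 12 (by norm_num)
    simpa [ω] using h
  have h6 : ω ^ 6 = -1 := by
    rw [show ω ^ 6 = (ω ^ 3) ^ 2 by ring, h3, Complex.I_sq]
  have h4 : ω ^ 2 + 1 ≠ 0 := by
    intro h
    exact hprim.pow_ne_one_of_pos_of_lt (l := 4) (by norm_num) (by norm_num)
      (by linear_combination (ω ^ 2 - 1) * h)
  apply mul_left_cancel₀ h4
  linear_combination h6

lemma α_inv : α⁻¹ = !![ω ^ 5, 0; 0, ω ^ 7] := by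
  have h := ω_cyclotomic
  apply Matrix.inv_eq_right_inv
  ext i j
  fin_cases i <;> fin_cases j <;> simp [α] <;> grind

lemma β_inv : β⁻¹ = !![ω ^ 5, -ω ^ 3; 0, ω ^ 7] := by
  have h := ω_cyclotomic
  apply Matrix.inv_eq_right_inv
  ext i j
  fin_cases i <;> fin_cases j <;> simp [β] <;> grind

lemma γ_inv : γ⁻¹ = !![ω ^ 7, 0; -ω ^ 3, ω ^ 5] := by
  have h := ω_cyclotomic
  apply Matrix.inv_eq_right_inv
  ext i j
  fin_cases i <;> fin_cases j <;> simp [γ] <;> grind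

lemma X_eq : X = !![ω ^ 2, -ω ^ 2; 0, 1 - ω ^ 2] := by
  have h := ω_cyclotomic
  ext i j
  fin_cases i <;> fin_cases j <;> simp [X, β, α] <;> grind

lemma Y_eq : Y = !![1 - ω ^ 2, 0; 1 - ω ^ 2, ω ^ 2] := by
  have h := ω_cyclotomic
  ext i j
  fin_cases i <;> fin_cases j <;> simp [Y, α_inv, γ] <;> grind

lemma Z_eq : Z = !![1, ω ^ 2 - 1; ω ^ 2, 0] := by
  have h := ω_cyclotomic
  ext i j
  fin_cases i <;> fin_cases j <;> simp [Z, γ_inv, β_inv] <;> grind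

lemma x_eq : x = !![1 - ω ^ 2, ω ^ 2; 0, ω ^ 2] := by
  have h := ω_cyclotomic
  apply Matrix.inv_eq_right_inv
  rw [X_eq]
  ext i j
  fin_cases i <;> fin_cases j <;> simp <;> grind

lemma y_eq : y = !![ω ^ 2, 0; ω ^ 2 - 1, 1 - ω ^ 2] := by
  have h := ω_cyclotomic
  apply Matrix.inv_eq_right_inv
  rw [Y_eq]
  ext i j
  fin_cases i <;> fin_cases j <;> simp <;> grind

lemma z_eq : z = !![0, 1 - ω ^ 2; -ω ^ 2, 1] := by
  have h := ω_cyclotomic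
  apply Matrix.inv_eq_right_inv
  rw [Z_eq]
  ext i j
  fin_cases i <;> fin_cases j <;> simp <;> grind

/-- The two stone boundary words in the letters X, Y, Z evaluate to minus the identity matrix. -/
theorem stone_words_XYZ_eq_neg_one :
    Z * Z * Y * Y * X * X = -(1 : Matrix (Fin 2) (Fin 2) ℂ) ∧
    y * Z * x * Y * z * X = -(1 : Matrix (Fin 2) (Fin 2) ℂ) := by
  have h := ω_cyclotomic
  rw [x_eq, y_eq, z_eq, X_eq, Y_eq, Z_eq]
  constructor <;> ext i j <;> fin_cases i <;> fin_cases j <;> simp <;> grind
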